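/- Fix κ ∈ (0, 1/6) and δ ∈ (0,1). Then for all x ≥ 2 and all integers ℓ with 2 ≤ ℓ ≤ x^{1/6−κ}, one has ∑_{p ≤ x} |S_ℓ(p)|⁶ ≪_{κ,δ} (x / log x) · ℓ^{3+δ}, where the sum is over odd primes p ≤ x. -/

import Mathlib

open Finset Filter

noncomputable section

/-- `S ℓ p = ∑_{n ≤ ℓ} (n/p)`, the quadratic character sum (Legendre symbol for odd prime `p`). -/
def S (ℓ p : ℕ) : ℤ := ∑ n ∈ Finset.Icc 1 ℓ, jacobiSym (n : ℤ) p

/-- the first-passage time `f_ε(p) = min {ℓ ≥ 1 : S_ℓ(p) < ε ℓ}`. -/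
def fpt (ε : ℝ) (p : ℕ) : ℕ := sInf {ℓ : ℕ | 1 ≤ ℓ ∧ ((S ℓ p : ℝ)) < ε * ℓ}

/-- the odd primes up to a real number `x`. -/
def oddPrimesUpTo (x : ℝ) : Finset ℕ :=
  (Finset.range (⌊x⌋₊ + 1)).filter (fun p => p.Prime ∧ p ≠ 2)

/-- `π_odd(x)`, the number of odd primes up to `x`. -/
def piOdd (x : ℝ) : ℕ := (oddPrimesUpTo x).card

/-- `P_ℓ(x)`, the density of odd primes `p ≤ x` with `S_ℓ(p) ≥ ε ℓ`. -/
def Pdens (ε : ℝ) (ℓ : ℕ) (x : ℝ) : ℝ :=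
  (((oddPrimesUpTo x).filter (fun p => ε * ℓ ≤ (S ℓ p : ℝ))).card : ℝ) / (piOdd x : ℝ)

/-- `a_m(x) = N_m(x)/π_odd(x)`, the proportion of odd primes `p ≤ x` with `f_ε(p) > m`. -/
def aCoef (ε : ℝ) (m : ℕ) (x : ℝ) : ℝ :=
  (((oddPrimesUpTo x).filter (fun p => m < fpt ε p)).card : ℝ) / (piOdd x : ℝ)

/-- `c_u(ℓ)`, the number of triples `(a,b,c) ∈ {1,…,ℓ}³` with `abc = u`. -/
def cCoef (ℓ u : ℕ) : ℕ :=
  ((Finset.Icc 1 ℓ ×ˢ Finset.Icc 1 ℓ ×ˢ Finset.Icc 1 ℓ).filter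
    (fun t => t.1 * t.2.1 * t.2.2 = u)).card

/-- `C_3(ℓ) = ∑_{u,v ≤ ℓ³, uv = □} c_u(ℓ) c_v(ℓ)`. -/
def C3 (ℓ : ℕ) : ℕ :=
  ∑ q ∈ (Finset.Icc 1 (ℓ ^ 3) ×ˢ Finset.Icc 1 (ℓ ^ 3)).filter (fun q => IsSquare (q.1 * q.2)),
    cCoef ℓ q.1 * cCoef ℓ q.2


lemma div_bound (ε : ℝ) (hε : 0 < ε) : ∃ C : ℝ, 1 ≤ C ∧ ∀ n : ℕ, n ≠ 0 →
    (n.divisors.card : ℝ) ≤ C * (n : ℝ) ^ ε := by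
  have hl2 : 0 < Real.log 2 := Real.log_pos (by norm_num)
  set c : ℝ := min 1 (ε * Real.log 2) with hc
  have hc0 : 0 < c := lt_min one_pos (by positivity)
  have hc1 : c ≤ 1 := min_le_left _ _
  have hc2 : c ≤ ε * Real.log 2 := min_le_right _ _
  set M : ℝ := 1 / c with hM
  have hM1 : 1 ≤ M := by rw [hM, le_div_iff₀ hc0]; linarith
  set P : ℕ := ⌈(2:ℝ) ^ (1/ε)⌉₊ with hP
  refine ⟨M ^ P, one_le_pow₀ hM1, ?_⟩
  intro n hn
  rw [Nat.card_divisors hn]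
  have key : ∀ p ∈ n.primeFactors, ((n.factorization p + 1 : ℕ) : ℝ) ≤
      (if p < P then M else 1) * (((p : ℝ) ^ (n.factorization p)) ^ ε) := by
    intro p hp
    have hp2 : (2:ℝ) ≤ p := by exact_mod_cast (Nat.prime_of_mem_primeFactors hp).two_le
    set a := n.factorization p
    have e1 : ((p : ℝ) ^ a) ^ ε = ((p:ℝ) ^ ε) ^ a := by
      rw [← Real.rpow_natCast, ← Real.rpow_mul (by positivity), mul_comm, Real.rpow_mul (by positivity), Real.rpow_natCast]
    rw [e1]
    split_ifs with h
    · have h2 : (2:ℝ) ^ ε ≤ (p:ℝ) ^ ε := Real.rpow_le_rpow (by norm_num) hp2 hε.le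
      have h3 : 1 + c ≤ (2:ℝ) ^ ε := by
        rw [Real.rpow_def_of_pos (by norm_num)]
        have := Real.add_one_le_exp (Real.log 2 * ε)
        linarith
      have h4 : 1 + a * c ≤ ((p:ℝ) ^ ε) ^ a :=
        (one_add_mul_le_pow (by linarith) a).trans (pow_le_pow_left₀ (by linarith) (h3.trans h2) a)
      have h5 : M * (1 + a * c) ≤ M * ((p:ℝ) ^ ε) ^ a := mul_le_mul_of_nonneg_left h4 (by linarith)
      have h6 : M * (1 + a * c) = M + a := by rw [hM]; field_simp
      push_cast
      linarith
    · have h2 : (2:ℝ) ≤ (p:ℝ) ^ ε := by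
        have h7 : (2:ℝ) ^ (1/ε) ≤ p := (Nat.le_ceil _).trans (by exact_mod_cast not_lt.mp h)
        calc (2:ℝ) = ((2:ℝ) ^ (1/ε)) ^ ε := by
              rw [← Real.rpow_mul (by norm_num)]; field_simp; simp
          _ ≤ _ := Real.rpow_le_rpow (by positivity) h7 hε.le
      have h3 : (2:ℝ)^a ≤ ((p:ℝ) ^ ε) ^ a := pow_le_pow_left₀ (by norm_num) h2 a
      have h4 : ((a + 1 : ℕ) : ℝ) ≤ (2:ℝ)^a := by exact_mod_cast (Nat.lt_two_pow_self : a < 2^a)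
      linarith
  have hn' : (n : ℝ) ^ ε = ∏ p ∈ n.primeFactors, ((p : ℝ) ^ (n.factorization p)) ^ ε := by
    rw [Real.finsetProd_rpow _ _ (fun i _ => by positivity)]
    congr 1
    conv_lhs => rw [← Nat.prod_factorization_pow_eq_self hn]
    rw [Finsupp.prod]; push_cast; rfl
  rw [hn']
  push_cast
  calc ∏ p ∈ n.primeFactors, ((n.factorization p : ℝ) + 1)
      ≤ ∏ p ∈ n.primeFactors, ((if p < P then M else 1) * (((p : ℝ) ^ (n.factorization p)) ^ ε)) := by
        apply Finset.prod_le_prod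
        · intros; positivity
        · intro p hp; exact_mod_cast key p hp
    _ = (∏ p ∈ n.primeFactors, (if p < P then M else 1)) * _ := Finset.prod_mul_distrib
    _ ≤ _ := by
        apply mul_le_mul_of_nonneg_right _ (Finset.prod_nonneg fun _ _ => by positivity)
        rw [← Finset.prod_filter, Finset.prod_const]
        apply pow_le_pow_right₀ hM1
        calc _ ≤ (range P).card := card_le_card (by intro p; simp +contextual)
          _ = P := by simp

lemma sq_count (δ : ℝ) (hδ : 0 < δ) : ∃ C : ℝ, 0 < C ∧ ∀ ℓ : ℕ, 1 ≤ ℓ →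
    (((Fintype.piFinset (fun _ : Fin 6 => Icc 1 ℓ)).filter
      (fun v => IsSquare (∏ i, v i))).card : ℝ) ≤ C * (ℓ : ℝ) ^ (3 + δ) := by
  obtain ⟨C, hC, h⟩ := div_bound (δ/36) (by positivity)
  refine ⟨C^6, by positivity, ?_⟩
  intro ℓ hℓ
  have hℓ' : (1:ℝ) ≤ ℓ := by exact_mod_cast hℓ
  have hsub : ((Fintype.piFinset (fun _ : Fin 6 => Icc 1 ℓ)).filter
      (fun v => IsSquare (∏ i, v i))) ⊆ (Icc 1 (ℓ^3)).biUnion (fun k =>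
        Fintype.piFinset (fun _ : Fin 6 => (k^2).divisors)) := by
    intro v hv
    simp only [mem_filter, Fintype.mem_piFinset, mem_Icc, mem_biUnion] at hv ⊢
    obtain ⟨hv, k, hk⟩ := hv
    have hpos : 0 < ∏ i, v i := Finset.prod_pos (fun i _ => (hv i).1)
    have hk0 : 0 < k := by
      rcases Nat.eq_zero_or_pos k with h0 | h0
      · subst h0; omega
      · exact h0
    have hle : ∏ i, v i ≤ ℓ ^ 6 := by
      calc ∏ i, v i ≤ ∏ _i : Fin 6, ℓ := Finset.prod_le_prod' (fun i _ => (hv i).2)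
        _ = ℓ ^ 6 := by simp
    refine ⟨k, ⟨hk0, ?_⟩, ?_⟩
    · apply le_of_not_gt
      intro hlt
      have : (ℓ^3)^2 < k^2 := Nat.pow_lt_pow_left hlt (by norm_num)
      have : (ℓ^3)^2 = ℓ^6 := by ring
      have : k^2 = k * k := by ring
      omega
    · intro i
      rw [Nat.mem_divisors]
      refine ⟨?_, by positivity⟩
      rw [sq, ← hk]
      exact Finset.dvd_prod_of_mem _ (mem_univ i)
  have h1 : (((Fintype.piFinset (fun _ : Fin 6 => Icc 1 ℓ)).filter
      (fun v => IsSquare (∏ i, v i))).card : ℝ) ≤ ∑ k ∈ Icc 1 (ℓ^3), (((k^2).divisors.card : ℝ))^6 := by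
    have := (card_le_card hsub).trans card_biUnion_le
    refine (Nat.cast_le.mpr this).trans ?_
    push_cast
    apply Finset.sum_le_sum
    intro k hk
    simp
  refine h1.trans ?_
  have h2 : ∀ k ∈ Icc 1 (ℓ^3), (((k^2).divisors.card : ℝ))^6 ≤ C^6 * (ℓ:ℝ)^δ := by
    intro k hk
    simp only [mem_Icc] at hk
    have hk3 : (k:ℝ) ≤ (ℓ:ℝ)^3 := by exact_mod_cast hk.2
    have := h (k^2) (by have := hk.1; positivity)
    have h3 : (((k^2 : ℕ) : ℝ))^(δ/36) ≤ (ℓ:ℝ)^(δ/6) := by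
      have : (ℓ:ℝ)^(δ/6) = ((ℓ:ℝ)^6)^(δ/36) := by
        rw [← Real.rpow_natCast, ← Real.rpow_mul (by positivity)]; congr 1; push_cast; ring
      rw [this]
      apply Real.rpow_le_rpow (by positivity) _ (by positivity)
      push_cast
      calc (k:ℝ)^2 ≤ ((ℓ:ℝ)^3)^2 := pow_le_pow_left₀ (by positivity) hk3 2
        _ = _ := by ring
    calc (((k^2).divisors.card : ℝ))^6 ≤ (C * (ℓ:ℝ)^(δ/6))^6 := by
          apply pow_le_pow_left₀ (by positivity)
          exact this.trans (mul_le_mul_of_nonneg_left h3 (by linarith))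
      _ = C^6 * (ℓ:ℝ)^δ := by
          rw [mul_pow, ← Real.rpow_natCast ((ℓ:ℝ)^(δ/6)), ← Real.rpow_mul (by positivity)]
          congr 2; push_cast; ring
  refine (Finset.sum_le_sum h2).trans ?_
  rw [Finset.sum_const, Nat.card_Icc, nsmul_eq_mul, Real.rpow_add (by linarith)]
  push_cast
  have : (ℓ:ℝ)^(3:ℝ) = (ℓ:ℝ)^3 := by exact_mod_cast Real.rpow_natCast (ℓ:ℝ) 3
  rw [this]
  apply le_of_eq; ring


lemma geom_bd {q : ℕ} [NeZero q] (k : ZMod q) (hk : k ≠ 0) (N : ℕ) :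
    ‖∑ j ∈ range N, ZMod.stdAddChar (k * (j : ZMod q))‖ ≤
      (q : ℝ) / 2 * (1 / (k.val : ℝ) + 1 / ((q : ℝ) - k.val)) := by
  have hv0 : 0 < k.val := Nat.pos_of_ne_zero (by rwa [Ne, ZMod.val_eq_zero])
  have hvq : k.val < q := ZMod.val_lt k
  have hq0 : (0:ℝ) < q := by exact_mod_cast (hv0.trans hvq)
  have hv0' : (0:ℝ) < k.val := by exact_mod_cast hv0
  have hvq' : (k.val:ℝ) < q := by exact_mod_cast hvq
  set ζ : ℂ := ZMod.stdAddChar k with hζ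
  have hterm : ∀ j : ℕ, ZMod.stdAddChar (k * (j : ZMod q)) = ζ ^ j := by
    intro j
    rw [hζ, ← AddChar.map_nsmul_eq_pow, nsmul_eq_mul, mul_comm]
  have hζe : ζ = Complex.exp (Complex.I * ((2 * Real.pi * (k.val / q) : ℝ) : ℂ)) := by
    rw [hζ]
    have : k = ((k.val : ℤ) : ZMod q) := by simp
    conv_lhs => rw [this]
    rw [ZMod.stdAddChar_coe]
    congr 1; push_cast; ring
  have hnorm : ‖ζ - 1‖ = 2 * Real.sin (Real.pi * (k.val / q)) := by
    rw [hζe, Complex.norm_exp_I_mul_ofReal_sub_one, Real.norm_eq_abs]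
    rw [show 2 * Real.pi * ((k.val:ℝ) / q) / 2 = Real.pi * (k.val / q) by ring]
    apply abs_of_nonneg
    have : 0 ≤ Real.sin (Real.pi * (k.val / q)) := by
      apply Real.sin_nonneg_of_nonneg_of_le_pi (by positivity)
      have : (k.val:ℝ) / q ≤ 1 := by rw [div_le_one hq0]; linarith
      nlinarith [Real.pi_pos]
    linarith
  set t : ℝ := (k.val : ℝ) / q with ht
  have ht0 : 0 < t := by positivity
  have ht1 : t < 1 := by rw [ht, div_lt_one hq0]; exact hvq'
  have hsin : 2 * t * (1 - t) ≤ Real.sin (Real.pi * t) := by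
    have hpi := Real.pi_pos
    rcases le_total t (1/2) with h | h
    · have := Real.mul_le_sin (x := Real.pi * t) (by positivity) (by nlinarith)
      have e : 2 / Real.pi * (Real.pi * t) = 2 * t := by field_simp
      nlinarith
    · have := Real.mul_le_sin (x := Real.pi * (1-t)) (by nlinarith) (by nlinarith)
      have e : 2 / Real.pi * (Real.pi * (1-t)) = 2 * (1-t) := by field_simp
      rw [show Real.pi * (1-t) = Real.pi - Real.pi * t by ring, Real.sin_pi_sub] at this
      rw [show Real.pi - Real.pi * t = Real.pi * (1-t) by ring, e] at this
      nlinarith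
  have hsp : 0 < 2 * t * (1 - t) := by have : 0 < 1 - t := by linarith
                                       positivity
  have hζ1 : ζ ≠ 1 := by
    intro h; rw [h] at hnorm; simp at hnorm; linarith
  rw [Finset.sum_congr rfl (fun j _ => hterm j), geom_sum_eq hζ1, norm_div, hnorm]
  have hnum : ‖ζ ^ N - 1‖ ≤ 2 := by
    have h1 : ‖ζ‖ = 1 := by rw [hζ]; exact AddChar.norm_apply _ _
    calc ‖ζ ^ N - 1‖ ≤ ‖ζ^N‖ + ‖(1:ℂ)‖ := norm_sub_le _ _
      _ = 2 := by rw [norm_pow, h1]; norm_num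
  calc ‖ζ ^ N - 1‖ / (2 * Real.sin (Real.pi * t)) ≤ 2 / (2 * (2 * t * (1 - t))) := by
        apply div_le_div₀ (by norm_num) hnum (by linarith) (by linarith)
    _ = _ := by
        have : (q:ℝ) - k.val ≠ 0 := by linarith
        have e : 1 - t = (q - k.val)/q := by rw [ht]; field_simp
        rw [e, ht]; field_simp; ring

lemma gauss_norm {q : ℕ} [NeZero q] (χ : DirichletCharacter ℂ q) (hχ : χ.IsPrimitive) :
    ‖gaussSum χ ZMod.stdAddChar‖ = Real.sqrt q := by
  have h := congrFun (ZMod.dft_dft (N := q) (χ : ZMod q → ℂ)) (-1)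
  rw [ZMod.dft_apply] at h
  simp only [hχ.fourierTransform_eq_inv_mul_gaussSum, neg_neg, smul_eq_mul, map_one, mul_one, mul_neg] at h
  have h2 : (∑ x : ZMod q, ZMod.stdAddChar x * (χ⁻¹ (-x) * gaussSum χ ZMod.stdAddChar)) =
     star (gaussSum χ ZMod.stdAddChar) * gaussSum χ ZMod.stdAddChar := by
    rw [star_gaussSum_eq]
    rw [show gaussSum χ⁻¹ (ZMod.stdAddChar (N := q))⁻¹ = ∑ x, χ⁻¹ x * (ZMod.stdAddChar (N := q))⁻¹ x from rfl, Finset.sum_mul]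
    rw [← Equiv.sum_comp (Equiv.neg (ZMod q))]
    apply Finset.sum_congr rfl
    intro x _
    simp [AddChar.inv_apply]
    ring
  rw [h2] at h
  have h3 : ‖gaussSum χ ZMod.stdAddChar‖ ^ 2 = q := by
    have := congrArg norm h
    rw [norm_mul, norm_star] at this
    simp at this
    rw [sq]; exact this
  rw [← h3, Real.sqrt_sq (norm_nonneg _)]

lemma pv_prim {q : ℕ} [NeZero q] (χ : DirichletCharacter ℂ q) (hχ : χ.IsPrimitive) (hq : 1 < q)
    (N : ℕ) : ‖∑ m ∈ range N, χ (m : ZMod q)‖ ≤ Real.sqrt q * (1 + Real.log q) := by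
  have hq0 : (0:ℝ) < q := by positivity
  have hinv : ∀ j : ZMod q, (q : ℂ) * χ j =
      ∑ k : ZMod q, ZMod.stdAddChar (k * j) * (χ⁻¹ (-k) * gaussSum χ ZMod.stdAddChar) := by
    intro j
    have h := congrFun (ZMod.dft_dft (N := q) (χ : ZMod q → ℂ)) (-j)
    rw [ZMod.dft_apply] at h
    simp only [hχ.fourierTransform_eq_inv_mul_gaussSum, neg_neg, smul_eq_mul, mul_neg] at h
    exact h.symm
  have hsum : (q : ℂ) * ∑ m ∈ range N, χ (m : ZMod q) =
      ∑ k : ZMod q, (χ⁻¹ (-k) * gaussSum χ ZMod.stdAddChar) *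
        ∑ m ∈ range N, ZMod.stdAddChar (k * (m : ZMod q)) := by
    rw [Finset.mul_sum, Finset.sum_congr rfl (fun (m : ℕ) _ => hinv (m : ZMod q)), Finset.sum_comm]
    apply Finset.sum_congr rfl
    intro k _
    rw [Finset.mul_sum]
    apply Finset.sum_congr rfl
    intro m _
    ring
  have : Nontrivial (ZMod q) := ZMod.nontrivial_iff.mpr hq.ne'
  have hbd : ‖(q : ℂ) * ∑ m ∈ range N, χ (m : ZMod q)‖ ≤
      ∑ k ∈ (univ : Finset (ZMod q)).erase 0, Real.sqrt q *
        ((q : ℝ) / 2 * (1 / (k.val : ℝ) + 1 / ((q : ℝ) - k.val))) := by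
    rw [hsum, ← Finset.sum_erase (s := univ) (a := (0 : ZMod q))]
    · apply norm_sum_le_of_le
      intro k hk
      rw [norm_mul, norm_mul, gauss_norm χ hχ]
      have h1 : ‖χ⁻¹ (-k)‖ ≤ 1 := DirichletCharacter.norm_le_one _ _
      have h2 := geom_bd k (Finset.ne_of_mem_erase hk) N
      calc ‖χ⁻¹ (-k)‖ * Real.sqrt q * _ ≤ 1 * Real.sqrt q * _ := by gcongr
        _ ≤ _ := by rw [one_mul]; gcongr
    · have : χ⁻¹ (-0 : ZMod q) = 0 := by rw [neg_zero]; exact MulChar.map_zero _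
      rw [this]; simp
  have hre : ∑ k ∈ (univ : Finset (ZMod q)).erase 0, Real.sqrt q *
        ((q : ℝ) / 2 * (1 / (k.val : ℝ) + 1 / ((q : ℝ) - k.val))) =
      ∑ v ∈ Ioo 0 q, Real.sqrt q * ((q : ℝ) / 2 * (1 / (v : ℝ) + 1 / ((q : ℝ) - v))) := by
    apply Finset.sum_bij (fun k _ => k.val)
    · intro k hk
      simp only [mem_erase, mem_univ, and_true] at hk
      simp only [mem_Ioo]
      exact ⟨Nat.pos_of_ne_zero (by rwa [Ne, ZMod.val_eq_zero]), ZMod.val_lt k⟩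
    · intro a _ b _ h; exact ZMod.val_injective q h
    · intro b hb
      simp only [mem_Ioo] at hb
      refine ⟨(b : ZMod q), ?_, ZMod.val_cast_of_lt hb.2⟩
      simp only [mem_erase, mem_univ, and_true]
      intro h0
      have := ZMod.val_cast_of_lt hb.2
      rw [h0] at this; simp at this; omega
    · intros; rfl
  have hrefl : ∑ v ∈ Ioo 0 q, 1 / ((q:ℝ) - v) = ∑ v ∈ Ioo 0 q, 1 / (v:ℝ) := by
    apply Finset.sum_bij (fun v _ => q - v)
    · intro v hv; simp only [mem_Ioo] at hv ⊢; omega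
    · intro a ha b hb h; simp only [mem_Ioo] at ha hb; omega
    · intro b hb; simp only [mem_Ioo] at hb; exact ⟨q - b, by simp only [mem_Ioo]; omega, by omega⟩
    · intro v hv; simp only [mem_Ioo] at hv; rw [Nat.cast_sub hv.2.le]
  have hharm : ∑ v ∈ Ioo 0 q, 1 / (v:ℝ) ≤ 1 + Real.log q := by
    have h1 := harmonic_le_one_add_log q
    rw [harmonic_eq_sum_Icc] at h1
    push_cast at h1
    refine le_trans ?_ h1
    simp only [one_div]
    apply Finset.sum_le_sum_of_subset_of_nonneg
    · intro v; simp only [mem_Ioo, mem_Icc]; omega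
    · intros; positivity
  rw [hre, ← Finset.mul_sum, ← Finset.mul_sum, Finset.sum_add_distrib, hrefl, norm_mul] at hbd
  simp only [Complex.norm_natCast] at hbd
  have : (q:ℝ) * ‖∑ m ∈ range N, χ (m : ZMod q)‖ ≤ q * (Real.sqrt q * (1 + Real.log q)) := by
    refine hbd.trans ?_
    calc _ = q * (Real.sqrt q * ∑ v ∈ Ioo 0 q, 1 / (v:ℝ)) := by ring
      _ ≤ _ := by gcongr
  exact le_of_mul_le_mul_left this hq0

lemma sum_dvd_mul (f : ℕ → ℂ) (hf : ∀ a b, f (a * b) = f a * f b) (d N : ℕ) (hd : 0 < d) :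
    ∑ m ∈ Icc 1 N, (if d ∣ m then f m else 0) = f d * ∑ k ∈ Icc 1 (N / d), f k := by
  rw [← Finset.sum_filter, Finset.mul_sum]
  symm
  apply Finset.sum_bij (fun k _ => d * k)
  · intro k hk
    simp only [mem_Icc, mem_filter] at hk ⊢
    have := (Nat.le_div_iff_mul_le hd).mp hk.2
    refine ⟨⟨Nat.mul_pos hd hk.1, by rw [mul_comm]; exact this⟩, Dvd.intro _ rfl⟩
  · intro a _ b _ h; exact Nat.eq_of_mul_eq_mul_left hd h
  · intro b hb
    simp only [mem_Icc, mem_filter] at hb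
    obtain ⟨⟨h1, h2⟩, k, rfl⟩ := hb
    refine ⟨k, ?_, rfl⟩
    simp only [mem_Icc]
    refine ⟨Nat.pos_of_mul_pos_left h1, (Nat.le_div_iff_mul_le hd).mpr (by rw [mul_comm]; exact h2)⟩
  · intro a _; exact (hf d a).symm

lemma sum_moeb (n : ℕ) : ∑ d ∈ n.divisors, ArithmeticFunction.moebius d = if n = 1 then 1 else 0 := by
  rw [← ArithmeticFunction.coe_zeta_mul_apply, ArithmeticFunction.coe_zeta_mul_moebius,
    ArithmeticFunction.one_apply]

lemma pv {q : ℕ} [NeZero q] (χ : DirichletCharacter ℂ q) (hχ : χ ≠ 1) (N : ℕ) :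
    ‖∑ m ∈ Icc 1 N, χ (m : ZMod q)‖ ≤ q.divisors.card * (Real.sqrt q * (1 + Real.log q)) := by
  set f := χ.conductor with hf
  have hf0 : f ≠ 0 := DirichletCharacter.conductor_ne_zero χ
  have : NeZero f := ⟨hf0⟩
  have hf1 : f ≠ 1 := fun h => hχ ((DirichletCharacter.eq_one_iff_conductor_eq_one).mpr h)
  have hfgt : 1 < f := by omega
  have hdvd : f ∣ q := DirichletCharacter.conductor_dvd_level χ
  have hfq : f ≤ q := Nat.le_of_dvd (Nat.pos_of_ne_zero (NeZero.ne q)) hdvd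
  set ψ := χ.primitiveCharacter with hψ
  have : Nontrivial (ZMod f) := ZMod.nontrivial_iff.mpr hf1
  have hB : ∀ K : ℕ, ‖∑ m ∈ Icc 1 K, ψ (m : ZMod f)‖ ≤ Real.sqrt q * (1 + Real.log q) := by
    intro K
    have h := pv_prim ψ χ.primitiveCharacter_isPrimitive hfgt (K+1)
    have e : ∑ m ∈ range (K+1), ψ (m : ZMod f) = ∑ m ∈ Icc 1 K, ψ (m : ZMod f) := by
      rw [Finset.range_eq_Ico, Finset.sum_eq_sum_Ico_succ_bot (by omega)]
      simp only [Nat.cast_zero]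
      rw [MulChar.map_zero, zero_add]
      rfl
    rw [e] at h
    refine h.trans ?_
    have hfr : (1:ℝ) ≤ f := by exact_mod_cast hfgt.le
    have hfq' : (f:ℝ) ≤ q := by exact_mod_cast hfq
    have := Real.log_nonneg hfr
    have := Real.log_le_log (by linarith) hfq'
    have := Real.sqrt_le_sqrt hfq'
    gcongr
  have hval : ∀ m ∈ Icc 1 N, χ (m : ZMod q) =
      ∑ d ∈ q.divisors, ((ArithmeticFunction.moebius d : ℤ) : ℂ) * (if d ∣ m then ψ (m : ZMod f) else 0) := by
    intro m hm
    simp only [mem_Icc] at hm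
    have h1 : ∑ d ∈ q.divisors, ((ArithmeticFunction.moebius d : ℤ) : ℂ) * (if d ∣ m then ψ (m : ZMod f) else 0)
       = (∑ d ∈ (Nat.gcd m q).divisors, ((ArithmeticFunction.moebius d : ℤ) : ℂ)) * ψ (m : ZMod f) := by
      have : (Nat.gcd m q).divisors = q.divisors.filter (fun d => d ∣ m) := by
        ext d
        simp only [Nat.mem_divisors, mem_filter, Nat.dvd_gcd_iff]
        have := NeZero.ne q
        have : Nat.gcd m q ≠ 0 := by intro h; rw [Nat.gcd_eq_zero_iff] at h; omega
        tauto
      rw [this, Finset.sum_filter, Finset.sum_mul]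
      apply Finset.sum_congr rfl
      intro d _
      split_ifs <;> simp
    have h2 : (∑ d ∈ (Nat.gcd m q).divisors, ((ArithmeticFunction.moebius d : ℤ) : ℂ)) =
        if Nat.gcd m q = 1 then 1 else 0 := by
      have := sum_moeb (Nat.gcd m q)
      rw [← Int.cast_sum, this]
      split_ifs <;> simp
    rw [h1, h2]
    split_ifs with hg
    · rw [one_mul]
      have hc : IsCoprime (m : ℤ) (q : ℤ) := Nat.isCoprime_iff_coprime.mpr hg
      have := DirichletCharacter.primitiveCharacter_apply_of_isCoprime χ hc
      simpa using this.symm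
    · rw [zero_mul]
      apply MulChar.map_nonunit
      rw [ZMod.isUnit_iff_coprime]
      exact hg
  rw [Finset.sum_congr rfl hval, Finset.sum_comm]
  calc _ ≤ ∑ d ∈ q.divisors, (Real.sqrt q * (1 + Real.log q)) := by
        apply norm_sum_le_of_le
        intro d hd
        have hd0 : 0 < d := Nat.pos_of_mem_divisors hd
        rw [← Finset.mul_sum, sum_dvd_mul (fun m => ψ (m : ZMod f)) (by intro a b; simp) d N hd0]
        rw [norm_mul, norm_mul]
        have h1 : ‖((ArithmeticFunction.moebius d : ℤ) : ℂ)‖ ≤ 1 := by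
          rw [Complex.norm_intCast]
          exact_mod_cast ArithmeticFunction.abs_moebius_le_one
        have h2 : ‖ψ (d : ZMod f)‖ ≤ 1 := DirichletCharacter.norm_le_one _ _
        have h3 := hB (N / d)
        calc _ ≤ 1 * (1 * (Real.sqrt q * (1 + Real.log q))) := by gcongr
          _ = _ := by ring
    _ = _ := by rw [Finset.sum_const, nsmul_eq_mul]


open scoped NumberTheorySymbols in
lemma exists_jac_neg (n : ℕ) (hn : 0 < n) (hsq : ¬ IsSquare n) :
    ∃ m : ℕ, Odd m ∧ J((n : ℤ) | m) = -1 := by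
  obtain ⟨a, u, hu, hnu⟩ := Nat.exists_eq_two_pow_mul_odd hn.ne'
  have hu0 : u ≠ 0 := by rintro rfl; simp at hu
  -- evaluation
  have heval : ∀ m : ℕ, m % 4 = 1 → J((n : ℤ) | m) = J((2:ℤ) | m) ^ a * J((m:ℤ) | u) := by
    intro m hm
    have hm2 : Odd m := Nat.odd_iff.mpr (by omega)
    rw [hnu]
    push_cast
    rw [jacobiSym.mul_left, jacobiSym.pow_left, jacobiSym.quadratic_reciprocity_one_mod_four' hu hm]
  by_cases hus : IsSquare u
  · have ha : Odd a := by
      by_contra h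
      rw [Nat.not_odd_iff_even] at h
      obtain ⟨b, rfl⟩ := h
      apply hsq
      rw [hnu]
      exact IsSquare.mul ⟨2^b, by rw [pow_add]⟩ hus
    have hcop : Nat.Coprime 8 u := by
      have : Nat.Coprime (2^3) u := Nat.Coprime.pow_left 3 (Nat.coprime_two_left.mpr hu)
      simpa using this
    obtain ⟨m, hm1, hm2⟩ := Nat.chineseRemainder hcop 5 1
    have hm8 : m % 8 = 5 := by simpa [Nat.ModEq] using hm1
    refine ⟨m, Nat.odd_iff.mpr (by omega), ?_⟩
    rw [heval m (by omega), jacobiSym.at_two (Nat.odd_iff.mpr (by omega))]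
    have h1 : ZMod.χ₈ (m : ZMod 8) = -1 := by
      rw [ZMod.χ₈_nat_mod_eight, hm8]; rfl
    have h2 : J((m:ℤ) | u) = 1 := by
      rw [jacobiSym.mod_left' (a₂ := 1), jacobiSym.one_left]
      exact_mod_cast hm2
    rw [h1, h2, ha.neg_one_pow]; norm_num
  · -- a prime with odd exponent
    have : ∃ p, p.Prime ∧ ∃ k t, Odd k ∧ ¬ p ∣ t ∧ u = p ^ k * t := by
      obtain ⟨r, s, hrs, hr⟩ := Nat.sq_mul_squarefree u
      have hr1 : r ≠ 1 := by
        rintro rfl; exact hus ⟨s, by rw [← hrs]; ring⟩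
      obtain ⟨p, hp, hpr⟩ := Nat.exists_prime_and_dvd hr1
      have hr0 : r ≠ 0 := by rintro rfl; exact hu0 (by rw [← hrs]; simp)
      have hs0 : s ≠ 0 := by rintro rfl; exact hu0 (by rw [← hrs]; simp)
      refine ⟨p, hp, u.factorization p, u / p ^ (u.factorization p), ?_,
        Nat.not_dvd_ordCompl hp hu0, (Nat.ordProj_mul_ordCompl_eq_self u p).symm⟩
      rw [← hrs, Nat.factorization_mul (pow_ne_zero _ hs0) hr0, Nat.factorization_pow]
      have : r.factorization p = 1 := by
        have h1 := hr.natFactorization_le_one p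
        have h2 := (hp.dvd_iff_one_le_factorization hr0).mp hpr
        omega
      simp [this]
    obtain ⟨p, hp, k, t, hk, hpt, hut⟩ := this
    have hfp : Fact p.Prime := ⟨hp⟩
    have hpodd : Odd p := by
      rw [hut] at hu
      have := (Nat.odd_mul.mp hu).1
      exact (Nat.odd_pow_iff (by rintro rfl; simp at hk)).mp this
    have htodd : Odd t := by
      rw [hut] at hu; exact (Nat.odd_mul.mp hu).2
    have ht0 : t ≠ 0 := by rintro rfl; simp at htodd
    obtain ⟨g, hg⟩ := FiniteField.exists_nonsquare (F := ZMod p) (by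
      rw [ZMod.ringChar_zmod_n]; rintro rfl; revert hpodd; decide)
    have hcop : Nat.Coprime (8 * t) p := by
      rw [Nat.coprime_comm, hp.coprime_iff_not_dvd]
      intro h
      rcases (hp.dvd_mul).mp h with h | h
      · have : p ∣ 2 := hp.dvd_of_dvd_pow (show p ∣ 2^3 by simpa using h)
        have := (Nat.prime_dvd_prime_iff_eq hp Nat.prime_two).mp this
        subst this; revert hpodd; decide
      · exact hpt h
    obtain ⟨m, hm1, hm2⟩ := Nat.chineseRemainder hcop 1 g.val
    have hm8 : m % 8 = 1 := by
      have : m ≡ 1 [MOD 8] := Nat.ModEq.of_mul_right t hm1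
      simpa [Nat.ModEq] using this
    have hmt : m ≡ 1 [MOD t] := Nat.ModEq.of_mul_left 8 hm1
    refine ⟨m, Nat.odd_iff.mpr (by omega), ?_⟩
    rw [heval m (by omega), jacobiSym.at_two (Nat.odd_iff.mpr (by omega))]
    have h1 : ZMod.χ₈ (m : ZMod 8) = 1 := by
      rw [ZMod.χ₈_nat_mod_eight, hm8]; rfl
    have h2 : J((m:ℤ) | t) = 1 := by
      rw [jacobiSym.mod_left' (a₂ := 1), jacobiSym.one_left]
      exact_mod_cast hmt
    have h3 : J((m:ℤ) | p) = -1 := by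
      rw [← jacobiSym.legendreSym.to_jacobiSym, legendreSym.eq_neg_one_iff]
      have : ((m : ℤ) : ZMod p) = g := by
        have := (ZMod.natCast_eq_natCast_iff m g.val p).mpr hm2
        push_cast
        rw [this]; simp
      rw [this]; exact hg
    have hp0 := hp.ne_zero
    rw [h1, hut, jacobiSym.mul_right' _ (pow_ne_zero _ hp0) ht0, jacobiSym.pow_right, h2, h3, hk.neg_one_pow]
    simp

noncomputable def jj (n m : ℕ) : ℝ := if Odd m then (jacobiSym (n : ℤ) m : ℝ) else 0

lemma exists_char (n : ℕ) (hn : 0 < n) : ∃ χ : DirichletCharacter ℂ (4 * n),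
    (∀ m : ℕ, χ (m : ZMod (4 * n)) = (jj n m : ℂ)) ∧ (¬ IsSquare n → χ ≠ 1) := by
  have hne : NeZero (4 * n) := ⟨by omega⟩
  have hmod : ∀ m : ℕ, jj n (m % (4 * n)) = jj n m := by
    intro m
    unfold jj
    have hpar : Odd (m % (4 * n)) ↔ Odd m := by
      rw [Nat.odd_iff, Nat.odd_iff, Nat.mod_mod_of_dvd]
      exact ⟨2 * n, by ring⟩
    by_cases h : Odd m
    · rw [if_pos h, if_pos (hpar.mpr h), ← jacobiSym.mod_right' n h]
    · rw [if_neg h, if_neg (fun h' => h (hpar.mp h'))]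
  have hmul : ∀ a b : ℕ, jj n (a * b) = jj n a * jj n b := by
    intro a b
    unfold jj
    by_cases ha : Odd a
    · by_cases hb : Odd b
      · rw [if_pos ha, if_pos hb, if_pos (ha.mul hb), jacobiSym.mul_right' _ ha.pos.ne' hb.pos.ne']
        push_cast; rfl
      · rw [if_neg hb, if_neg (fun h => hb (Nat.odd_mul.mp h).2)]; simp
    · rw [if_neg ha, if_neg (fun h => ha (Nat.odd_mul.mp h).1)]; simp
  let χ : DirichletCharacter ℂ (4 * n) :=
    { toFun := fun a => (jj n a.val : ℂ)
      map_one' := by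
        rw [ZMod.val_one'' (by omega)]
        simp [jj]
      map_mul' := by
        intro a b
        rw [ZMod.val_mul, hmod, hmul]; push_cast; rfl
      map_nonunit' := by
        intro a ha
        rw [← ZMod.natCast_zmod_val a, ZMod.isUnit_iff_coprime] at ha
        simp only [jj]
        split_ifs with h
        · rw [jacobiSym.eq_zero_iff.mpr]
          · simp
          · refine ⟨h.pos.ne', ?_⟩
            intro h1
            apply ha
            apply Nat.Coprime.mul_right
            · have : Nat.Coprime a.val (2^2) := Nat.Coprime.pow_right 2 (Nat.coprime_two_right.mpr h)
              simpa using this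
            · rw [Nat.coprime_comm]; rw [Int.gcd_natCast_natCast] at h1; exact h1
        · simp }
  have hχ : ∀ m : ℕ, χ (m : ZMod (4 * n)) = (jj n m : ℂ) := by
    intro m
    change (jj n (m : ZMod (4*n)).val : ℂ) = _
    rw [ZMod.val_natCast, hmod]
  refine ⟨χ, hχ, ?_⟩
  intro hsq h1
  obtain ⟨m, hm, hmj⟩ := exists_jac_neg n hn hsq
  have h2 := hχ m
  rw [jj, if_pos hm, hmj, h1] at h2
  by_cases hu : IsUnit (m : ZMod (4*n))
  · rw [MulChar.one_apply hu] at h2; norm_num at h2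
  · rw [MulChar.map_nonunit _ hu] at h2; norm_num at h2

lemma H_lower (R : ℕ) : Real.log (R + 1) / 2 ≤
    ∑ r ∈ Icc 1 R, ((ArithmeticFunction.moebius r : ℤ) : ℝ) ^ 2 / r := by
  have hsq : ∀ R : ℕ, ∑ s ∈ Icc 1 R, (1:ℝ) / (s:ℝ)^2 ≤ 2 - 1 / (R:ℝ) := by
    intro R
    induction R with
    | zero => simp
    | succ k ih =>
      rw [Finset.sum_Icc_succ_top (by omega)]
      push_cast
      rcases Nat.eq_zero_or_pos k with h0 | h0
      · subst h0; norm_num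
      · have hk : (1:ℝ) ≤ k := by exact_mod_cast h0
        have : (1:ℝ) / ((k:ℝ)+1)^2 ≤ 1/((k:ℝ)) - 1/((k:ℝ)+1) := by
          rw [div_sub_div _ _ (by positivity) (by positivity), div_le_div_iff₀ (by positivity) (by positivity)]
          nlinarith
        linarith
  have hsq2 : ∑ s ∈ Icc 1 R, (1:ℝ) / (s:ℝ)^2 ≤ 2 := (hsq R).trans (by
    have : (0:ℝ) ≤ 1 / (R:ℝ) := by positivity
    linarith)
  have h1 : Real.log (R + 1) ≤ ∑ m ∈ Icc 1 R, (1:ℝ) / m := by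
    have := log_add_one_le_harmonic R
    rw [harmonic_eq_sum_Icc] at this
    push_cast at this
    simpa using this
  set A := ((Icc 1 R) ×ˢ (Icc 1 R)).filter (fun p : ℕ × ℕ => Squarefree p.1) with hA
  have h2 : ∑ m ∈ Icc 1 R, (1:ℝ) / m ≤ ∑ p ∈ A, (1:ℝ) / ((p.2^2 * p.1 : ℕ) : ℝ) := by
    have hsub : Icc 1 R ⊆ A.image (fun p => p.2^2 * p.1) := by
      intro m hm
      simp only [mem_Icc] at hm
      obtain ⟨r, s, hrs, hr⟩ := Nat.sq_mul_squarefree m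
      simp only [mem_image, hA, mem_filter, mem_product, mem_Icc]
      have hr0 : 0 < r := Nat.pos_of_ne_zero (by rintro rfl; simp at hrs; omega)
      have hs0 : 0 < s := Nat.pos_of_ne_zero (by rintro rfl; simp at hrs; omega)
      refine ⟨(r, s), ⟨⟨⟨hr0, ?_⟩, ⟨hs0, ?_⟩⟩, hr⟩, hrs⟩
      · have : r ≤ s^2 * r := Nat.le_mul_of_pos_left _ (by positivity)
        simp only; omega
      · have h1 : s^2 ≤ s^2 * r := Nat.le_mul_of_pos_right _ hr0
        have h2 : s ≤ s^2 := Nat.le_self_pow (by norm_num) s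
        simp only; omega
    refine (Finset.sum_le_sum_of_subset_of_nonneg hsub (fun _ _ _ => by positivity)).trans ?_
    exact Finset.sum_image_le_of_nonneg (f := fun m : ℕ => (1:ℝ)/m) (fun _ _ => by positivity)
  have h3 : ∑ p ∈ A, (1:ℝ) / ((p.2^2 * p.1 : ℕ) : ℝ) =
      (∑ r ∈ Icc 1 R, ((ArithmeticFunction.moebius r : ℤ) : ℝ) ^ 2 / r) * ∑ s ∈ Icc 1 R, (1:ℝ) / (s:ℝ)^2 := by
    rw [hA, Finset.sum_filter, Finset.sum_mul_sum, Finset.sum_product]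
    apply Finset.sum_congr rfl; intro r _
    apply Finset.sum_congr rfl; intro s _
    have := ArithmeticFunction.moebius_sq (n := r)
    have h' : ((ArithmeticFunction.moebius r : ℤ) : ℝ) ^ 2 = if Squarefree r then 1 else 0 := by
      rw [← Int.cast_pow, this]; split_ifs <;> simp
    rw [h']
    split_ifs
    · push_cast; field_simp
    · simp
  have hH0 : 0 ≤ ∑ r ∈ Icc 1 R, ((ArithmeticFunction.moebius r : ℤ) : ℝ) ^ 2 / r :=
    Finset.sum_nonneg (fun _ _ => by positivity)
  have := mul_le_mul_of_nonneg_left hsq2 hH0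
  linarith

lemma moeb_inv (R r s : ℕ) (hr : 1 ≤ r) (hs : 1 ≤ s) (hsR : s ≤ R) :
    ∑ d ∈ Icc 1 R, (if r ∣ d ∧ d ∣ s then ((ArithmeticFunction.moebius (s / d) : ℤ) : ℝ) else 0) =
      if s = r then 1 else 0 := by
  by_cases hrs : r ∣ s
  · obtain ⟨t, rfl⟩ := hrs
    have ht : 0 < t := Nat.pos_of_ne_zero (by rintro rfl; simp at hs)
    rw [← Finset.sum_filter]
    have : ∑ d ∈ (Icc 1 R).filter (fun d => r ∣ d ∧ d ∣ r * t), ((ArithmeticFunction.moebius (r * t / d) : ℤ) : ℝ)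
        = ∑ e ∈ t.divisors, ((ArithmeticFunction.moebius (t / e) : ℤ) : ℝ) := by
      symm
      apply Finset.sum_bij (fun e _ => r * e)
      · intro e he
        have he0 := Nat.pos_of_mem_divisors he
        have hed := Nat.dvd_of_mem_divisors he
        simp only [mem_filter, mem_Icc]
        have h1 : r * e ∣ r * t := Nat.mul_dvd_mul_left r hed
        exact ⟨⟨Nat.mul_pos hr he0, (Nat.le_of_dvd hs h1).trans hsR⟩, Dvd.intro _ rfl, h1⟩
      · intro a _ b _ h; exact Nat.eq_of_mul_eq_mul_left hr h
      · intro d hd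
        simp only [mem_filter, mem_Icc] at hd
        obtain ⟨_, ⟨e, rfl⟩, h2⟩ := hd
        exact ⟨e, Nat.mem_divisors.mpr ⟨Nat.dvd_of_mul_dvd_mul_left hr h2, ht.ne'⟩, rfl⟩
      · intro e he
        rw [Nat.mul_div_mul_left _ _ hr]
    rw [this, Nat.sum_div_divisors t (fun e => ((ArithmeticFunction.moebius e : ℤ) : ℝ)), ← Int.cast_sum, sum_moeb]
    have : r * t = r ↔ t = 1 := by
      constructor
      · intro h; exact Nat.eq_of_mul_eq_mul_left hr (by omega)
      · rintro rfl; simp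
    simp only [this]
    split_ifs <;> simp
  · rw [if_neg (by rintro rfl; exact hrs dvd_rfl)]
    apply Finset.sum_eq_zero
    intro d _
    rw [if_neg]
    rintro ⟨h1, h2⟩; exact hrs (h1.trans h2)

noncomputable def ww (R : ℕ) (lam : ℕ → ℝ) (m : ℕ) : ℝ :=
  (∑ d ∈ Icc 1 R, if d ∣ m then lam d else 0) ^ 2

lemma ww_expand (R : ℕ) (lam : ℕ → ℝ) (m : ℕ) : ww R lam m =
    ∑ d ∈ Icc 1 R, ∑ e ∈ Icc 1 R, lam d * lam e * (if Nat.lcm d e ∣ m then 1 else 0) := by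
  rw [ww, sq, Finset.sum_mul_sum]
  apply Finset.sum_congr rfl; intro d _
  apply Finset.sum_congr rfl; intro e _
  simp only [Nat.lcm_dvd_iff]
  by_cases h1 : d ∣ m <;> by_cases h2 : e ∣ m <;> simp [h1, h2]

lemma selberg (R : ℕ) (hR : 1 ≤ R) : ∃ lam : ℕ → ℝ, lam 1 = 1 ∧ (∀ d ∈ Icc 1 R, |lam d| ≤ R) ∧
    ∑ d ∈ Icc 1 R, ∑ e ∈ Icc 1 R, lam d * lam e / (Nat.lcm d e : ℝ) ≤ 2 / Real.log (R + 1) := by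
  set H := ∑ r ∈ Icc 1 R, ((ArithmeticFunction.moebius r : ℤ) : ℝ) ^ 2 / r with hH
  have hlog : 0 < Real.log ((R:ℝ) + 1) := Real.log_pos (by have : (1:ℝ) ≤ R := by exact_mod_cast hR
                                                           linarith)
  have hHl := H_lower R
  rw [← hH] at hHl
  have hH0 : 0 < H := by linarith
  set μ : ℕ → ℝ := fun r => ((ArithmeticFunction.moebius r : ℤ) : ℝ) with hμ
  have hμ1 : ∀ r, |μ r| ≤ 1 := by
    intro r; simp only [hμ]; exact_mod_cast ArithmeticFunction.abs_moebius_le_one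
  set y : ℕ → ℝ := fun r => μ r / (r * H) with hy
  set lam : ℕ → ℝ := fun d => d * ∑ s ∈ Icc 1 R, if d ∣ s then μ (s / d) * y s else 0 with hlam
  have hHsum : ∑ s ∈ Icc 1 R, μ s * y s = 1 := by
    have : ∀ s ∈ Icc 1 R, μ s * y s = (μ s ^ 2 / s) / H := by
      intro s _; simp only [hy]; rw [div_div]; ring
    rw [Finset.sum_congr rfl this, ← Finset.sum_div]
    exact div_self hH0.ne'
  refine ⟨lam, ?_, ?_, ?_⟩
  · simp only [hlam]; simpa using hHsum
  · intro d hd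
    simp only [mem_Icc] at hd
    simp only [hlam]
    rw [abs_mul, Nat.abs_cast]
    have : |∑ s ∈ Icc 1 R, if d ∣ s then μ (s / d) * y s else 0| ≤ 1 := by
      rw [← hHsum]
      refine (Finset.abs_sum_le_sum_abs _ _).trans (Finset.sum_le_sum ?_)
      intro s _
      have e : μ s * y s = |μ s| * (1 / (s * H)) * |μ s| := by
        simp only [hy]
        rw [show |μ s| * (1 / (s * H)) * |μ s| = |μ s| * |μ s| * (1 / (s * H)) by ring, abs_mul_abs_self]
        ring
      have e2 : μ s * y s = |y s| := by
        have hi : μ s * μ s = |μ s| := by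
          simp only [hμ]
          rcases ArithmeticFunction.moebius_eq_or s with h | h | h <;> simp [h]
        simp only [hy]
        rw [abs_div, abs_of_nonneg (show (0:ℝ) ≤ s * H by positivity), ← hi]; ring
      rw [e2]
      split_ifs
      · rw [abs_mul]
        have := mul_le_mul_of_nonneg_right (hμ1 (s/d)) (abs_nonneg (y s))
        linarith
      · simp
    calc (d:ℝ) * _ ≤ d * 1 := by gcongr
      _ ≤ R := by rw [mul_one]; exact_mod_cast hd.2
  · have hY : ∀ r ∈ Icc 1 R, ∑ d ∈ Icc 1 R, (if r ∣ d then lam d / d else 0) = y r := by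
      intro r hr
      have hr' := mem_Icc.mp hr
      have h1 : ∀ d ∈ Icc 1 R, (if r ∣ d then lam d / d else 0) =
          ∑ s ∈ Icc 1 R, y s * (if r ∣ d ∧ d ∣ s then μ (s / d) else 0) := by
        intro d hd
        have hd' := mem_Icc.mp hd
        have hd0 : (d:ℝ) ≠ 0 := by have := hd'.1; positivity
        by_cases h : r ∣ d
        · rw [if_pos h]
          simp only [hlam]
          rw [mul_div_cancel_left₀ _ hd0]
          apply Finset.sum_congr rfl; intro s _
          by_cases h2 : d ∣ s <;> simp [h, h2, mul_comm]
        · simp [h]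
      rw [Finset.sum_congr rfl h1, Finset.sum_comm]
      have h2 : ∀ s ∈ Icc 1 R, ∑ d ∈ Icc 1 R, y s * (if r ∣ d ∧ d ∣ s then μ (s / d) else 0) =
          if s = r then y s else 0 := by
        intro s hs
        have hs' := mem_Icc.mp hs
        rw [← Finset.mul_sum]
        have := moeb_inv R r s hr'.1 hs'.1 hs'.2
        simp only [hμ]
        rw [this]; split_ifs <;> simp
      rw [Finset.sum_congr rfl h2, Finset.sum_ite_eq' , if_pos hr]
    have hQ : ∑ d ∈ Icc 1 R, ∑ e ∈ Icc 1 R, lam d * lam e / (Nat.lcm d e : ℝ) =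
        ∑ r ∈ Icc 1 R, (Nat.totient r : ℝ) * (y r)^2 := by
      have h1 : ∀ r ∈ Icc 1 R, (Nat.totient r : ℝ) * (y r)^2 =
          ∑ d ∈ Icc 1 R, ∑ e ∈ Icc 1 R, lam d / d * (lam e / e) * (if r ∣ d ∧ r ∣ e then (Nat.totient r : ℝ) else 0) := by
        intro r hr
        rw [← hY r hr, sq, Finset.sum_mul_sum, Finset.mul_sum]
        apply Finset.sum_congr rfl; intro d _
        rw [Finset.mul_sum]
        apply Finset.sum_congr rfl; intro e _
        by_cases h1 : r ∣ d <;> by_cases h2 : r ∣ e <;> simp [h1, h2] <;> ring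
      rw [Finset.sum_congr rfl h1]
      conv_rhs => rw [Finset.sum_comm]
      apply Finset.sum_congr rfl; intro d hd
      conv_rhs => rw [Finset.sum_comm]
      apply Finset.sum_congr rfl; intro e he
      have hd' := mem_Icc.mp hd
      have he' := mem_Icc.mp he
      rw [← Finset.mul_sum]
      have hg : ∑ r ∈ Icc 1 R, (if r ∣ d ∧ r ∣ e then (Nat.totient r : ℝ) else 0) = (Nat.gcd d e : ℝ) := by
        conv_rhs => rw [← Nat.sum_totient (Nat.gcd d e)]
        push_cast
        rw [← Finset.sum_filter]
        apply Finset.sum_congr _ (fun _ _ => rfl)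
        have hg0 : Nat.gcd d e ≠ 0 := Nat.gcd_ne_zero_left (by omega)
        ext r
        simp only [mem_filter, mem_Icc, Nat.mem_divisors, Nat.dvd_gcd_iff]
        constructor
        · rintro ⟨_, h⟩; exact ⟨h, hg0⟩
        · rintro ⟨h, _⟩
          exact ⟨⟨Nat.pos_of_dvd_of_pos h.1 hd'.1, (Nat.le_of_dvd hd'.1 h.1).trans hd'.2⟩, h⟩
      rw [hg]
      have hgl : (Nat.gcd d e : ℝ) * (Nat.lcm d e : ℝ) = d * e := by exact_mod_cast Nat.gcd_mul_lcm d e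
      have hd0 : (d:ℝ) ≠ 0 := by have := hd'.1; positivity
      have he0 : (e:ℝ) ≠ 0 := by have := he'.1; positivity
      have hl0 : (Nat.lcm d e : ℝ) ≠ 0 := by
        exact_mod_cast Nat.lcm_ne_zero (by omega) (by omega)
      field_simp
      linear_combination (-(lam d * lam e)) * hgl
    rw [hQ]
    calc ∑ r ∈ Icc 1 R, (Nat.totient r : ℝ) * (y r)^2 ≤ ∑ r ∈ Icc 1 R, (μ r ^ 2 / r) / H^2 := by
          apply Finset.sum_le_sum
          intro r hr
          have hr' := mem_Icc.mp hr
          have hr0 : (0:ℝ) < r := by exact_mod_cast hr'.1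
          have ht : (Nat.totient r : ℝ) ≤ r := by exact_mod_cast Nat.totient_le r
          calc (Nat.totient r : ℝ) * (y r)^2 ≤ r * (y r)^2 := by gcongr
            _ = _ := by simp only [hy]; field_simp
      _ = 1 / H := by
          rw [← Finset.sum_div]
          change H / H^2 = _
          field_simp
      _ ≤ 1 / (Real.log (R + 1) / 2) := one_div_le_one_div_of_le (by linarith) hHl
      _ = _ := by rw [one_div_div]

lemma sum_abs_lam (R : ℕ) (lam : ℕ → ℝ) (h : ∀ d ∈ Icc 1 R, |lam d| ≤ R) :
    ∑ d ∈ Icc 1 R, ∑ e ∈ Icc 1 R, |lam d * lam e| ≤ (R:ℝ)^4 := by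
  calc _ ≤ ∑ d ∈ Icc 1 R, ∑ e ∈ Icc 1 R, (R:ℝ) * R := by
        apply Finset.sum_le_sum; intro d hd
        apply Finset.sum_le_sum; intro e he
        rw [abs_mul]
        have := h d hd
        have := h e he
        gcongr
    _ = _ := by simp; ring

lemma ww_total (R : ℕ) (lam : ℕ → ℝ) (h : ∀ d ∈ Icc 1 R, |lam d| ≤ R) (N : ℕ) :
    ∑ m ∈ Icc 1 N, ww R lam m ≤
      N * (∑ d ∈ Icc 1 R, ∑ e ∈ Icc 1 R, lam d * lam e / (Nat.lcm d e : ℝ)) + (R:ℝ)^4 := by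
  rw [Finset.sum_congr rfl (fun m _ => ww_expand R lam m), Finset.sum_comm]
  refine le_trans ?_ (add_le_add_right (sum_abs_lam R lam h) _)
  rw [Finset.mul_sum, ← Finset.sum_add_distrib]
  apply Finset.sum_le_sum; intro d hd
  rw [Finset.sum_comm, Finset.mul_sum, ← Finset.sum_add_distrib]
  apply Finset.sum_le_sum; intro e he
  rw [← Finset.mul_sum]
  have hd' := mem_Icc.mp hd
  have he' := mem_Icc.mp he
  have hl0 : 0 < Nat.lcm d e := Nat.lcm_pos hd'.1 he'.1
  have hcount : ∑ m ∈ Icc 1 N, (if Nat.lcm d e ∣ m then (1:ℝ) else 0) = ((N / Nat.lcm d e : ℕ) : ℝ) := by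
    rw [← Finset.sum_filter, Finset.sum_const, nsmul_eq_mul, mul_one]
    congr 1
    exact Nat.Ioc_filter_dvd_card_eq_div N (Nat.lcm d e)
  rw [hcount]
  set L := Nat.lcm d e
  have hL : (0:ℝ) < L := by exact_mod_cast hl0
  have h1 : ((N / L : ℕ) : ℝ) ≤ N / L := Nat.cast_div_le
  have h2 : (N:ℝ) / L - 1 ≤ ((N / L : ℕ) : ℝ) := by
    have := Nat.lt_div_mul_add (a := N) hl0
    have h' : (N:ℝ) ≤ ((N / L : ℕ) : ℝ) * L + L := by exact_mod_cast this.le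
    rw [sub_le_iff_le_add, div_le_iff₀ hL]; linarith
  have h3 : |((N / L : ℕ) : ℝ) - N / L| ≤ 1 := by rw [abs_le]; constructor <;> linarith
  have h4 : lam d * lam e * (((N / L : ℕ) : ℝ) - N / L) ≤ |lam d * lam e| := by
    refine (le_abs_self _).trans ?_
    rw [abs_mul]
    calc _ ≤ |lam d * lam e| * 1 := by gcongr
      _ = _ := mul_one _
  have : (N:ℝ) * (lam d * lam e / L) = lam d * lam e * (N / L) := by ring
  rw [this]; linarith

lemma ww_twist (R : ℕ) (lam : ℕ → ℝ) (h : ∀ d ∈ Icc 1 R, |lam d| ≤ R) (N : ℕ) (f : ℕ → ℂ)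
    (hf : ∀ a b, f (a * b) = f a * f b) (hf1 : ∀ a, ‖f a‖ ≤ 1) (B : ℝ)
    (hB : ∀ K, ‖∑ k ∈ Icc 1 K, f k‖ ≤ B) :
    ‖∑ m ∈ Icc 1 N, (ww R lam m : ℂ) * f m‖ ≤ (R:ℝ)^4 * B := by
  have hB0 : 0 ≤ B := (norm_nonneg _).trans (hB 0)
  have e : ∑ m ∈ Icc 1 N, (ww R lam m : ℂ) * f m =
      ∑ d ∈ Icc 1 R, ∑ e ∈ Icc 1 R, ((lam d * lam e : ℝ) : ℂ) *
        ∑ m ∈ Icc 1 N, (if Nat.lcm d e ∣ m then f m else 0) := by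
    have : ∀ m ∈ Icc 1 N, (ww R lam m : ℂ) * f m = ∑ d ∈ Icc 1 R, ∑ e ∈ Icc 1 R,
        ((lam d * lam e : ℝ) : ℂ) * (if Nat.lcm d e ∣ m then f m else 0) := by
      intro m _
      rw [ww_expand]
      push_cast
      rw [Finset.sum_mul]
      apply Finset.sum_congr rfl; intro d _
      rw [Finset.sum_mul]
      apply Finset.sum_congr rfl; intro e _
      split_ifs <;> simp
    rw [Finset.sum_congr rfl this, Finset.sum_comm]
    apply Finset.sum_congr rfl; intro d _
    rw [Finset.sum_comm]
    apply Finset.sum_congr rfl; intro e _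
    rw [Finset.mul_sum]
  rw [e]
  calc _ ≤ ∑ d ∈ Icc 1 R, ∑ e ∈ Icc 1 R, |lam d * lam e| * B := by
        apply norm_sum_le_of_le; intro d hd
        apply norm_sum_le_of_le; intro e he
        have hl0 : 0 < Nat.lcm d e := Nat.lcm_pos (mem_Icc.mp hd).1 (mem_Icc.mp he).1
        rw [sum_dvd_mul f hf _ N hl0, norm_mul, norm_mul, Complex.norm_real, Real.norm_eq_abs]
        have h1 := hf1 (Nat.lcm d e)
        have h2 := hB (N / Nat.lcm d e)
        calc _ ≤ |lam d * lam e| * (1 * B) := by gcongr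
          _ = _ := by rw [one_mul]
    _ = (∑ d ∈ Icc 1 R, ∑ e ∈ Icc 1 R, |lam d * lam e|) * B := by
        simp only [Finset.sum_mul]
    _ ≤ _ := by
        apply mul_le_mul_of_nonneg_right (sum_abs_lam R lam h) hB0

lemma jj_abs (n m : ℕ) : |jj n m| ≤ 1 := by
  unfold jj
  split_ifs
  · rcases jacobiSym.trichotomy (n:ℤ) m with h | h | h <;> simp [h]
  · simp

lemma char_bound (ε : ℝ) (hε : 0 < ε) : ∃ C : ℝ, 0 < C ∧ ∀ ℓ n : ℕ, 1 ≤ ℓ → 1 ≤ n → n ≤ ℓ ^ 6 →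
    ¬ IsSquare n → ∀ (R : ℕ) (lam : ℕ → ℝ), (∀ d ∈ Icc 1 R, |lam d| ≤ R) → ∀ N : ℕ,
    ∑ m ∈ Icc 1 N, ww R lam m * jj n m ≤ (R:ℝ)^4 * (C * (ℓ:ℝ) ^ (3 + 12 * ε)) := by
  obtain ⟨C, hC, hdiv⟩ := div_bound ε hε
  refine ⟨C * (1 + 1/ε) * 4 ^ (1/2 + 2 * ε), by positivity, ?_⟩
  intro ℓ n hℓ hn hnℓ hsq R lam hlam N
  have hne : NeZero (4 * n) := ⟨by omega⟩
  have hex := exists_char n hn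
  obtain ⟨q, hq⟩ : ∃ q, q = 4 * n := ⟨_, rfl⟩
  rw [← hq] at hex hne
  obtain ⟨χ, hχ, hχ1⟩ := hex
  have hpv := pv χ (hχ1 hsq)
  have hq1 : (1:ℝ) ≤ q := by exact_mod_cast (by omega : 1 ≤ q)
  have hq0 : (0:ℝ) < q := by linarith
  have hB : (q.divisors.card : ℝ) * (Real.sqrt q * (1 + Real.log q)) ≤
      C * (1 + 1/ε) * 4 ^ (1/2 + 2 * ε) * (ℓ:ℝ) ^ (3 + 12 * ε) := by
    have h1 := hdiv q (by omega)
    have h2 : 1 + Real.log q ≤ (1 + 1/ε) * (q:ℝ)^ε := by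
      have h3 := Real.log_le_rpow_div hq0.le hε
      have h4 : 1 ≤ (q:ℝ)^ε := Real.one_le_rpow hq1 hε.le
      have : (q:ℝ)^ε / ε = 1/ε * (q:ℝ)^ε := by ring
      linarith
    have hlog := Real.log_nonneg hq1
    have h5 : (q:ℝ)^(1/2 + 2*ε) ≤ 4 ^ (1/2 + 2 * ε) * (ℓ:ℝ) ^ (3 + 12 * ε) := by
      have e : (ℓ:ℝ) ^ (3 + 12 * ε) = ((ℓ:ℝ)^6) ^ (1/2 + 2 * ε) := by
        rw [← Real.rpow_natCast, ← Real.rpow_mul (by positivity)]; congr 1; push_cast; ring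
      rw [e, ← Real.mul_rpow (by norm_num) (by positivity)]
      apply Real.rpow_le_rpow hq0.le _ (by positivity)
      rw [hq]; push_cast
      have : (n:ℝ) ≤ (ℓ:ℝ)^6 := by exact_mod_cast hnℓ
      linarith
    calc _ ≤ (C * (q:ℝ)^ε) * ((q:ℝ)^((1:ℝ)/2) * ((1 + 1/ε) * (q:ℝ)^ε)) := by
          rw [Real.sqrt_eq_rpow]; gcongr
      _ = C * (1 + 1/ε) * (q:ℝ)^(1/2 + 2*ε) := by
          rw [show 1/2 + 2*ε = ε + (1/2 + ε) by ring, Real.rpow_add hq0, Real.rpow_add hq0]; ring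
      _ ≤ C * (1 + 1/ε) * (4 ^ (1/2 + 2 * ε) * (ℓ:ℝ) ^ (3 + 12 * ε)) := by gcongr
      _ = _ := by ring
  have h := ww_twist R lam hlam N (fun m => χ (m : ZMod q)) (by intro a b; simp)
    (fun a => DirichletCharacter.norm_le_one _ _) _ (fun K => (hpv K).trans hB)
  have e : ∑ m ∈ Icc 1 N, (ww R lam m : ℂ) * χ (m : ZMod q) =
      ((∑ m ∈ Icc 1 N, ww R lam m * jj n m : ℝ) : ℂ) := by
    push_cast
    apply Finset.sum_congr rfl; intro m _
    rw [hχ]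
  rw [e, Complex.norm_real, Real.norm_eq_abs] at h
  exact (le_abs_self _).trans h

lemma ww_prime (R : ℕ) (hR : 1 ≤ R) (lam : ℕ → ℝ) (h1 : lam 1 = 1) (p : ℕ) (hp : p.Prime)
    (hpR : R < p) : ww R lam p = 1 := by
  have : ∑ d ∈ Icc 1 R, (if d ∣ p then lam d else 0) = 1 := by
    rw [Finset.sum_eq_single 1]
    · simp [h1]
    · intro d hd hd1
      rw [if_neg]
      intro hdp
      rcases (Nat.dvd_prime hp).mp hdp with h | h
      · exact hd1 h
      · have := (mem_Icc.mp hd).2; omega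
    · intro h; exact absurd (mem_Icc.mpr ⟨le_rfl, hR⟩) h
  rw [ww, this]; norm_num

lemma ww_nonneg (R : ℕ) (lam : ℕ → ℝ) (m : ℕ) : 0 ≤ ww R lam m := sq_nonneg _

lemma jj_prod (v : Fin 6 → ℕ) (m : ℕ) : ∏ i, jj (v i) m = jj (∏ i, v i) m := by
  have hmul : ∀ a b, jj (a * b) m = jj a m * jj b m := by
    intro a b; unfold jj
    split_ifs
    · push_cast; rw [jacobiSym.mul_left]; push_cast; rfl
    · simp
  rw [Fin.prod_univ_six, Fin.prod_univ_six]; simp only [hmul]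

lemma first_step (R : ℕ) (hR : 1 ≤ R) (lam : ℕ → ℝ) (h1 : lam 1 = 1) (x : ℝ) (ℓ : ℕ) :
    ∑ p ∈ oddPrimesUpTo x, |(S ℓ p : ℝ)| ^ 6 ≤ (R:ℝ) * (ℓ:ℝ)^6 +
      ∑ m ∈ Icc 1 ⌊x⌋₊, ww R lam m * (∑ n ∈ Icc 1 ℓ, jj n m)^6 := by
  have hS : ∀ p ∈ oddPrimesUpTo x, (S ℓ p : ℝ) = ∑ n ∈ Icc 1 ℓ, jj n p := by
    intro p hp
    simp only [oddPrimesUpTo, mem_filter] at hp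
    have hodd : Odd p := hp.2.1.odd_of_ne_two hp.2.2
    rw [S]; push_cast
    apply Finset.sum_congr rfl; intro n _
    rw [jj, if_pos hodd]
  have h6 : ∀ m, 0 ≤ (∑ n ∈ Icc 1 ℓ, jj n m)^6 := fun m => Even.pow_nonneg (by decide) _
  have hb : ∀ m, |∑ n ∈ Icc 1 ℓ, jj n m| ≤ ℓ := by
    intro m
    refine (Finset.abs_sum_le_sum_abs _ _).trans ((Finset.sum_le_sum (fun n _ => jj_abs n m)).trans ?_)
    simp
  have hterm : ∀ p ∈ oddPrimesUpTo x, |(S ℓ p : ℝ)| ^ 6 ≤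
      (if p ∈ Icc 1 R then (ℓ:ℝ)^6 else 0) + ww R lam p * (∑ n ∈ Icc 1 ℓ, jj n p)^6 := by
    intro p hp
    rw [hS p hp]
    simp only [oddPrimesUpTo, mem_filter] at hp
    split_ifs with hpR
    · have := mul_nonneg (ww_nonneg R lam p) (h6 p)
      have := pow_le_pow_left₀ (abs_nonneg _) (hb p) 6
      linarith
    · have : R < p := by
        have := hp.2.1.one_lt
        simp only [mem_Icc] at hpR; omega
      rw [ww_prime R hR lam h1 p hp.2.1 this, zero_add, one_mul, Even.pow_abs (by decide)]
  refine (Finset.sum_le_sum hterm).trans ?_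
  rw [Finset.sum_add_distrib]
  apply add_le_add
  · rw [← Finset.sum_filter, Finset.sum_const, nsmul_eq_mul]
    gcongr
    calc _ ≤ (Icc 1 R).card := card_le_card (by intro p hp; exact (mem_filter.mp hp).2)
      _ = R := by simp
  · apply Finset.sum_le_sum_of_subset_of_nonneg
    · intro p hp
      simp only [oddPrimesUpTo, mem_filter, mem_range] at hp
      have := hp.2.1.one_lt
      simp only [mem_Icc]; omega
    · intro m _ _
      exact mul_nonneg (ww_nonneg R lam m) (h6 m)

lemma second_step (R : ℕ) (lam : ℕ → ℝ) (N ℓ : ℕ) (B : ℝ) (hB : 0 ≤ B)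
    (hnd : ∀ n : ℕ, 1 ≤ n → n ≤ ℓ ^ 6 → ¬ IsSquare n → ∑ m ∈ Icc 1 N, ww R lam m * jj n m ≤ B) :
    ∑ m ∈ Icc 1 N, ww R lam m * (∑ n ∈ Icc 1 ℓ, jj n m)^6 ≤
      (((Fintype.piFinset (fun _ : Fin 6 => Icc 1 ℓ)).filter
        (fun v => IsSquare (∏ i, v i))).card : ℝ) * (∑ m ∈ Icc 1 N, ww R lam m) + (ℓ:ℝ)^6 * B := by
  set V := Fintype.piFinset (fun _ : Fin 6 => Icc 1 ℓ) with hV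
  have hexp : ∀ m, (∑ n ∈ Icc 1 ℓ, jj n m)^6 = ∑ v ∈ V, jj (∏ i, v i) m := by
    intro m
    have := Finset.prod_univ_sum (fun _ : Fin 6 => Icc 1 ℓ) (fun _ n => jj n m)
    rw [Finset.prod_const, Finset.card_univ, Fintype.card_fin] at this
    rw [this]
    apply Finset.sum_congr rfl; intro v _
    exact jj_prod v m
  have e : ∑ m ∈ Icc 1 N, ww R lam m * (∑ n ∈ Icc 1 ℓ, jj n m)^6 =
      ∑ v ∈ V, ∑ m ∈ Icc 1 N, ww R lam m * jj (∏ i, v i) m := by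
    rw [Finset.sum_comm]
    apply Finset.sum_congr rfl; intro m _
    rw [hexp, Finset.mul_sum]
  rw [e, ← Finset.sum_filter_add_sum_filter_not V (fun v => IsSquare (∏ i, v i))]
  apply add_le_add
  · rw [← nsmul_eq_mul]
    apply Finset.sum_le_card_nsmul
    intro v _
    apply Finset.sum_le_sum; intro m _
    have := mul_le_mul_of_nonneg_left ((le_abs_self _).trans (jj_abs (∏ i, v i) m)) (ww_nonneg R lam m)
    linarith
  · calc _ ≤ ((V.filter (fun v => ¬ IsSquare (∏ i, v i))).card) • B := by
          apply Finset.sum_le_card_nsmul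
          intro v hv
          rw [mem_filter, hV, Fintype.mem_piFinset] at hv
          simp only [mem_Icc] at hv
          apply hnd _ _ _ hv.2
          · exact Nat.one_le_iff_ne_zero.mpr (Finset.prod_pos (fun i _ => (hv.1 i).1)).ne'
          · calc ∏ i, v i ≤ ∏ _i : Fin 6, ℓ := Finset.prod_le_prod' (fun i _ => (hv.1 i).2)
              _ = ℓ ^ 6 := by simp
      _ ≤ _ := by
          rw [nsmul_eq_mul]
          gcongr
          have : (V.filter (fun v => ¬ IsSquare (∏ i, v i))).card ≤ ℓ ^ 6 := by
            refine (card_filter_le _ _).trans ?_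
            rw [hV, Fintype.card_piFinset]; simp
          exact_mod_cast this

lemma pow_le_xlog (a : ℝ) (ha : a < 1) (x : ℝ) (hx : 2 ≤ x) :
    x ^ a ≤ 1 / (1 - a) * (x / Real.log x) := by
  have hx0 : 0 < x := by linarith
  have hl : 0 < Real.log x := Real.log_pos (by linarith)
  have h := Real.log_le_rpow_div hx0.le (show 0 < 1 - a by linarith)
  have e : x ^ a * x ^ (1 - a) = x := by rw [← Real.rpow_add hx0]; simp
  have hxa : 0 < x ^ a := by positivity
  have h1a : 0 < 1 - a := by linarith
  rw [← mul_div_assoc, le_div_iff₀ hl]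
  calc x ^ a * Real.log x ≤ x ^ a * (x ^ (1 - a) / (1 - a)) := by gcongr
    _ = 1 / (1 - a) * (x ^ a * x ^ (1 - a)) := by ring
    _ = _ := by rw [e]

/-- For fixed `κ ∈ (0,1/6)` and `δ ∈ (0,1)`: for `x ≥ 2` and `2 ≤ ℓ ≤ x^(1/6-κ)`,
`∑_{p ≤ x} |S_ℓ(p)|⁶ ≪_{κ,δ} (x / log x) ℓ^(3+δ)`. -/
theorem stmt13 (κ δ : ℝ) (hκ : 0 < κ) (hκ' : κ < 1/6) (hδ : 0 < δ) (hδ1 : δ < 1) :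
    ∃ C : ℝ, 0 < C ∧ ∀ (x : ℝ) (ℓ : ℕ), 2 ≤ x → 2 ≤ ℓ → (ℓ : ℝ) ≤ x ^ ((1 : ℝ)/6 - κ) →
      ∑ p ∈ oddPrimesUpTo x, |(S ℓ p : ℝ)| ^ 6
        ≤ C * (x / Real.log x) * (ℓ : ℝ) ^ ((3 : ℝ) + δ) := by
  obtain ⟨C1, hC1, hD⟩ := sq_count δ hδ
  obtain ⟨C2, hC2, hch⟩ := char_bound (κ/2) (by positivity)
  refine ⟨2 + C1 * (2 / κ + 1 / (1 - 4 * κ)) + C2 * (1 / (1 - (1 - κ))), ?_, ?_⟩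
  · have : 0 < 1 - 4 * κ := by linarith
    have : 0 < 1 - (1 - κ) := by linarith
    positivity
  intro x ℓ hx hℓ hℓx
  have hx0 : 0 < x := by linarith
  have hx1 : 1 ≤ x := by linarith
  have hlx : 0 < Real.log x := Real.log_pos (by linarith)
  have hℓ1 : 1 ≤ ℓ := by omega
  have hL1 : (1:ℝ) ≤ ℓ := by exact_mod_cast hℓ1
  have hL0 : (0:ℝ) < ℓ := by linarith
  have hxκ : 1 ≤ x ^ κ := Real.one_le_rpow hx1 hκ.le
  set R : ℕ := ⌊x ^ κ⌋₊ with hRdef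
  have hR : 1 ≤ R := Nat.one_le_floor_iff _ |>.mpr hxκ
  have hRx : (R:ℝ) ≤ x ^ κ := Nat.floor_le (by positivity)
  have hRx' : x ^ κ ≤ (R:ℝ) + 1 := (Nat.lt_floor_add_one _).le
  have hR4 : (R:ℝ)^4 ≤ x ^ (4 * κ) := by
    calc (R:ℝ)^4 ≤ (x ^ κ)^4 := by gcongr
      _ = _ := by rw [← Real.rpow_natCast, ← Real.rpow_mul hx0.le]; congr 1; push_cast; ring
  obtain ⟨lam, hlam1, hlam, hQ⟩ := selberg R hR
  set N := ⌊x⌋₊ with hN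
  have hNx : (N:ℝ) ≤ x := Nat.floor_le hx0.le
  set X := x / Real.log x with hX
  have hX0 : 0 < X := by positivity
  have hlogR : κ * Real.log x ≤ Real.log (R + 1) := by
    rw [← Real.log_rpow hx0]; exact Real.log_le_log (by positivity) hRx'
  have hlR : 0 < Real.log ((R:ℝ) + 1) := lt_of_lt_of_le (by positivity) hlogR
  have hW : ∑ m ∈ Icc 1 N, ww R lam m ≤ (2 / κ + 1 / (1 - 4 * κ)) * X := by
    refine (ww_total R lam hlam N).trans ?_
    have h1 : (N:ℝ) * (∑ d ∈ Icc 1 R, ∑ e ∈ Icc 1 R, lam d * lam e / (Nat.lcm d e : ℝ)) ≤ 2 / κ * X := by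
      calc _ ≤ (N:ℝ) * (2 / Real.log (R + 1)) := by gcongr
        _ ≤ x * (2 / (κ * Real.log x)) := by gcongr
        _ = _ := by rw [hX]; field_simp
    have h2 := pow_le_xlog (4 * κ) (by linarith) x hx
    rw [← hX] at h2
    linarith
  have hW0 : 0 ≤ ∑ m ∈ Icc 1 N, ww R lam m := Finset.sum_nonneg (fun m _ => ww_nonneg R lam m)
  set B : ℝ := (R:ℝ)^4 * (C2 * (ℓ:ℝ) ^ (3 + 12 * (κ/2))) with hB
  have hB0 : 0 ≤ B := by positivity
  have s1 := first_step R hR lam hlam1 x ℓ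
  have s2 := second_step R lam N ℓ B hB0 (fun n h1 h2 h3 => hch ℓ n hℓ1 h1 h2 h3 R lam hlam N)
  have hD' := hD ℓ hℓ1
  set E := (ℓ:ℝ) ^ ((3:ℝ) + δ) with hE
  have hE0 : 0 < E := by positivity
  have h3E : (ℓ:ℝ) ^ (3:ℝ) ≤ E := Real.rpow_le_rpow_of_exponent_le hL1 (by linarith)
  have hpowx : ∀ a : ℝ, 0 ≤ a → (ℓ:ℝ) ^ a ≤ x ^ ((1/6 - κ) * a) := by
    intro a ha
    rw [Real.rpow_mul hx0.le]
    exact Real.rpow_le_rpow hL0.le hℓx ha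
  -- small primes
  have t1 : (R:ℝ) * (ℓ:ℝ)^6 ≤ 2 * X * E := by
    have e : (ℓ:ℝ)^6 = (ℓ:ℝ)^(3:ℝ) * (ℓ:ℝ)^(3:ℝ) := by
      rw [← Real.rpow_add hL0, ← Real.rpow_natCast]; norm_num
    have h1 := hpowx 3 (by norm_num)
    have h2 := pow_le_xlog (1/2) (by norm_num) x hx
    rw [← hX] at h2
    calc (R:ℝ) * (ℓ:ℝ)^6 ≤ x ^ κ * (x ^ ((1/6 - κ) * 3) * E) := by rw [e]; gcongr
      _ = x ^ (κ + (1/6 - κ) * 3) * E := by rw [Real.rpow_add hx0]; ring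
      _ ≤ x ^ ((1:ℝ)/2) * E := by
          gcongr
          linarith
      _ ≤ (1 / (1 - 1/2) * X) * E := by gcongr
      _ = _ := by norm_num
  have t2 : (((Fintype.piFinset (fun _ : Fin 6 => Icc 1 ℓ)).filter
        (fun v => IsSquare (∏ i, v i))).card : ℝ) * (∑ m ∈ Icc 1 N, ww R lam m) ≤
      C1 * (2 / κ + 1 / (1 - 4 * κ)) * X * E := by
    calc _ ≤ (C1 * E) * ((2 / κ + 1 / (1 - 4 * κ)) * X) := by gcongr
      _ = _ := by ring
  have t3 : (ℓ:ℝ)^6 * B ≤ C2 * (1 / (1 - (1 - κ))) * X * E := by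
    have e : (ℓ:ℝ)^6 * (ℓ:ℝ) ^ (3 + 12 * (κ/2)) = (ℓ:ℝ) ^ (6 + 6 * κ) * (ℓ:ℝ)^(3:ℝ) := by
      rw [← Real.rpow_natCast, ← Real.rpow_add hL0, ← Real.rpow_add hL0]; congr 1; push_cast; ring
    have h1 := hpowx (6 + 6 * κ) (by positivity)
    have h2 := pow_le_xlog (1 - κ) (by linarith) x hx
    rw [← hX] at h2
    calc (ℓ:ℝ)^6 * B = (R:ℝ)^4 * C2 * ((ℓ:ℝ)^6 * (ℓ:ℝ) ^ (3 + 12 * (κ/2))) := by rw [hB]; ring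
      _ ≤ x ^ (4 * κ) * C2 * (x ^ ((1/6 - κ) * (6 + 6 * κ)) * E) := by rw [e]; gcongr
      _ = C2 * x ^ (4 * κ + (1/6 - κ) * (6 + 6 * κ)) * E := by rw [Real.rpow_add hx0]; ring
      _ ≤ C2 * x ^ (1 - κ) * E := by
          gcongr
          nlinarith
      _ ≤ C2 * (1 / (1 - (1 - κ)) * X) * E := by gcongr
      _ = _ := by ring
  calc _ ≤ _ := s1
    _ ≤ 2 * X * E + (C1 * (2 / κ + 1 / (1 - 4 * κ)) * X * E + C2 * (1 / (1 - (1 - κ))) * X * E) := by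
        linarith
    _ = _ := by ring

end
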